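/- arXiv:2504.11694 — 2 statements merged into one kernel-verified Lean document; each statement's English description precedes it below -/
import Mathlib

section
/- Let w-σ_0 : (Q̄, μ_0) → ℕ and w-σ_1 : (Q̄, μ_1) → ℕ be weighted persistence diagrams over the same finite set Q ⊆ [0,∞) with identical weights μ_0 = μ_1. Then for every p ∈ [1,∞), d^{E,p}_wDgm(w-σ_0, w-σ_1) = 0. -/
/-!
STATEMENT 16: Let `w-σ₀ : (Q̄, μ₀) → ℕ` and `w-σ₁ : (Q̄, μ₁) → ℕ` be weighted
persistence diagrams over the same finite set `Q ⊆ [0,∞)` with identical weights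
`μ₀ = μ₁`.  Then for every `p ∈ [1,∞)`, `d^{E,p}_wDgm(w-σ₀, w-σ₁) = 0`.
-/


open scoped ENNReal

noncomputable section

/-- The set of intervals `Q̄` of a finite subset `Q ⊆ ℝ`, as pairs `(a,b)` with
`a ≤ b`, both in `Q`. -/
def Ibar (Q : Finset ℝ) : Finset (ℝ × ℝ) :=
  (Q ×ˢ Q).filter fun p => p.1 ≤ p.2

/-- The displacement `defo(I₁, I₂, J₁, J₂)` of two pairs of intervals. -/
def defo (I₁ I₂ J₁ J₂ : ℝ × ℝ) : ℝ :=
  max (max |(I₁.1 - I₂.1) - (J₁.1 - J₂.1)| |(I₁.1 - I₂.2) - (J₁.1 - J₂.2)|)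
      (max |(I₁.2 - I₂.1) - (J₁.2 - J₂.1)| |(I₁.2 - I₂.2) - (J₁.2 - J₂.2)|)

/-- A weighted persistence diagram. -/
structure WPDgm where
  Q : Finset ℝ
  nonneg : ∀ q ∈ Q, (0:ℝ) ≤ q
  zero_mem : (0:ℝ) ∈ Q
  dgm : ℝ × ℝ → ℕ
  supp : ∀ I, dgm I ≠ 0 → I ∈ Ibar Q
  w : ℝ × ℝ → ℝ
  w_nonneg : ∀ I, 0 ≤ w I
  w_supp : ∀ I, w I ≠ 0 → I ∈ Ibar Q
  w_sum : ∑ I ∈ Ibar Q, w I = 1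
  compat : ∀ I ∈ Ibar Q, I.1 ≠ I.2 → dgm I ≠ 0 → 0 < w I

/-- A weighted persistence diagram morphism: a persistence diagram morphism
(a Galois connection pushing the diagram forward off the diagonal) which is moreover
a Monge map for the weights. -/
structure WPDHom (P₁ P₂ : WPDgm) where
  f : ℝ → ℝ
  g : ℝ → ℝ
  f_mem : ∀ q ∈ P₁.Q, f q ∈ P₂.Q
  g_mem : ∀ r ∈ P₂.Q, g r ∈ P₁.Q
  f_mono : ∀ q ∈ P₁.Q, ∀ q' ∈ P₁.Q, q ≤ q' → f q ≤ f q'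
  g_mono : ∀ r ∈ P₂.Q, ∀ r' ∈ P₂.Q, r ≤ r' → g r ≤ g r'
  gc : ∀ q ∈ P₁.Q, ∀ r ∈ P₂.Q, (f q ≤ r ↔ q ≤ g r)
  push : ∀ J ∈ Ibar P₂.Q, J.1 ≠ J.2 →
    P₂.dgm J = ∑ I ∈ (Ibar P₁.Q).filter (fun I => (f I.1, f I.2) = J), P₁.dgm I
  monge : ∀ J ∈ Ibar P₂.Q,
    P₂.w J = ∑ I ∈ (Ibar P₁.Q).filter (fun I => (f I.1, f I.2) = J), P₁.w I

/-- The `p`-cost of a weighted persistence diagram morphism, `p ∈ [1,∞]`. -/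
def WPDHom.pcost {P₁ P₂ : WPDgm} (m : WPDHom P₁ P₂) (p : ℝ≥0∞) : ℝ :=
  if p = ⊤ then
    sSup {v | ∃ I₁ ∈ Ibar P₁.Q, ∃ I₂ ∈ Ibar P₁.Q,
      v = defo I₁ I₂ (m.f I₁.1, m.f I₁.2) (m.f I₂.1, m.f I₂.2)}
  else
    (∑ I₁ ∈ Ibar P₁.Q, ∑ I₂ ∈ Ibar P₁.Q,
        defo I₁ I₂ (m.f I₁.1, m.f I₁.2) (m.f I₂.1, m.f I₂.2) ^ p.toReal
          * P₁.w I₁ * P₁.w I₂) ^ (1 / p.toReal)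

/-- A zigzag path of weighted persistence diagram morphisms. -/
inductive WPDPath : WPDgm → WPDgm → Type
  | nil (P : WPDgm) : WPDPath P P
  | fwd {P₁ P₂ P₃ : WPDgm} (m : WPDHom P₁ P₂) (p : WPDPath P₂ P₃) : WPDPath P₁ P₃
  | bwd {P₁ P₂ P₃ : WPDgm} (m : WPDHom P₂ P₁) (p : WPDPath P₂ P₃) : WPDPath P₁ P₃

/-- The `p`-cost of a path: the sum of the `p`-costs of its morphisms. -/
def wpdPathCost (p : ℝ≥0∞) : ∀ {P₁ P₂ : WPDgm}, WPDPath P₁ P₂ → ℝ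
  | _, _, .nil _ => 0
  | _, _, .fwd m q => m.pcost p + wpdPathCost p q
  | _, _, .bwd m q => m.pcost p + wpdPathCost p q

/-- The `p`-edit distance between weighted persistence diagrams. -/
def editDistWDgm (p : ℝ≥0∞) (P₁ P₂ : WPDgm) : ℝ≥0∞ :=
  ⨅ q : WPDPath P₁ P₂, ENNReal.ofReal (wpdPathCost p q)


theorem mem_Ibar {Q : Finset ℝ} {I : ℝ × ℝ} :
    I ∈ Ibar Q ↔ I.1 ∈ Q ∧ I.2 ∈ Q ∧ I.1 ≤ I.2 := by
  simp [Ibar, and_assoc]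

theorem Ibar_mono {Q Q' : Finset ℝ} (h : Q ⊆ Q') : Ibar Q ⊆ Ibar Q' := by
  intro I hI
  rw [mem_Ibar] at hI ⊢
  exact ⟨h hI.1, h hI.2.1, hI.2.2⟩

/-- Concatenation of zigzag paths. -/
def WPDPath.trans : ∀ {P₁ P₂ P₃ : WPDgm}, WPDPath P₁ P₂ → WPDPath P₂ P₃ → WPDPath P₁ P₃
  | _, _, _, .nil _, r => r
  | _, _, _, .fwd m q, r => .fwd m (q.trans r)
  | _, _, _, .bwd m q, r => .bwd m (q.trans r)

theorem wpdPathCost_trans (p : ℝ≥0∞) {P₁ P₂ P₃ : WPDgm} (q : WPDPath P₁ P₂)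
    (r : WPDPath P₂ P₃) :
    wpdPathCost p (q.trans r) = wpdPathCost p q + wpdPathCost p r := by
  induction q with
  | nil => simp [WPDPath.trans, wpdPathCost]
  | fwd m q ih => simp [WPDPath.trans, wpdPathCost, ih, add_assoc]
  | bwd m q ih => simp [WPDPath.trans, wpdPathCost, ih, add_assoc]

theorem editDistWDgm_triangle (p : ℝ≥0∞) (P₁ P₂ P₃ : WPDgm) :
    editDistWDgm p P₁ P₃ ≤ editDistWDgm p P₁ P₂ + editDistWDgm p P₂ P₃ := by
  refine ENNReal.le_iInf_add_iInf fun q r => ?_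
  calc editDistWDgm p P₁ P₃ ≤ ENNReal.ofReal (wpdPathCost p (q.trans r)) := iInf_le _ _
    _ ≤ _ := by rw [wpdPathCost_trans]; exact ENNReal.ofReal_add_le

theorem editDistWDgm_le_pcost (p : ℝ≥0∞) {P₁ P₂ : WPDgm} (m : WPDHom P₁ P₂) :
    editDistWDgm p P₁ P₂ ≤ ENNReal.ofReal (m.pcost p) :=
  (iInf_le _ (.fwd m (.nil _))).trans_eq (by simp [wpdPathCost])

theorem editDistWDgm_le_pcost_swap (p : ℝ≥0∞) {P₁ P₂ : WPDgm} (m : WPDHom P₁ P₂) :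
    editDistWDgm p P₂ P₁ ≤ ENNReal.ofReal (m.pcost p) :=
  (iInf_le _ (.bwd m (.nil _))).trans_eq (by simp [wpdPathCost])

theorem defo_self (I₁ I₂ : ℝ × ℝ) : defo I₁ I₂ I₁ I₂ = 0 := by
  simp [defo]

/-- The multiplicities of a diagram on the diagonal do not affect the edit distance. -/
theorem editDistWDgm_eq_zero_of_eq_off_diag {p : ℝ≥0∞} (hp : 1 ≤ p) (hptop : p ≠ ⊤)
    {P₁ P₂ : WPDgm} (hQ : P₁.Q = P₂.Q) (hw : P₁.w = P₂.w)
    (hdgm : ∀ J : ℝ × ℝ, J.1 ≠ J.2 → P₁.dgm J = P₂.dgm J) :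
    editDistWDgm p P₁ P₂ = 0 := by
  have hp0 : 0 < p.toReal := ENNReal.toReal_pos (by positivity) hptop
  let m : WPDHom P₁ P₂ :=
    { f := id
      g := id
      f_mem := by simp [hQ]
      g_mem := by simp [hQ]
      f_mono := fun _ _ _ _ h => h
      g_mono := fun _ _ _ _ h => h
      gc := fun _ _ _ _ => Iff.rfl
      push := by
        intro J hJ hne
        simp [Finset.sum_filter, hQ, hJ, hdgm J hne]
      monge := by
        intro J hJ
        simp [Finset.sum_filter, hQ, hJ, hw] }
  have hm : m.pcost p = 0 := by
    simp [WPDHom.pcost, hptop, m, defo_self, Real.zero_rpow hp0.ne', hp0.ne']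
  simpa [hm] using editDistWDgm_le_pcost p m

/-- The function on intervals obtained from `w` by moving an amount `ε` from `I` to `J`. -/
def moveWeight (w : ℝ × ℝ → ℝ) (I J : ℝ × ℝ) (ε : ℝ) (K : ℝ × ℝ) : ℝ :=
  (w K - if K = I then ε else 0) + if K = J then ε else 0

/-- Starting from `P`, enlarge the set of endpoints to `Q'`, forget the multiplicity of `I`,
move an amount `ε` of weight from `I` to `J` and add `n` to the multiplicity of `J`. -/
def WPDgm.move (P : WPDgm) (Q' : Finset ℝ) (hsub : P.Q ⊆ Q') (hnonneg : ∀ q ∈ Q', (0 : ℝ) ≤ q)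
    (I J : ℝ × ℝ) (hJ : J ∈ Ibar Q') (ε : ℝ) (hε : 0 < ε) (hεI : ε < P.w I) (n : ℕ) : WPDgm where
  Q := Q'
  nonneg := hnonneg
  zero_mem := hsub P.zero_mem
  dgm K := (if K = I then 0 else P.dgm K) + if K = J then n else 0
  supp K hK := by
    by_cases hKJ : K = J
    · rwa [hKJ]
    · by_cases hKI : K = I
      · subst hKI
        simp [hKJ] at hK
      · exact Ibar_mono hsub (P.supp K (by simpa [hKI, hKJ] using hK))
  w := moveWeight P.w I J ε
  w_nonneg K := by
    have := P.w_nonneg K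
    unfold moveWeight
    split_ifs with h₁ h₂ h₂ <;> try subst h₁
    all_goals linarith
  w_supp K hK := by
    by_cases hKJ : K = J
    · rwa [hKJ]
    · refine Ibar_mono hsub (P.w_supp K fun h => ?_)
      by_cases hKI : K = I
      · subst hKI
        linarith
      · simp [moveWeight, h, hKI, hKJ] at hK
  w_sum := by
    have hI : I ∈ Ibar Q' := Ibar_mono hsub (P.w_supp I (by linarith))
    have hs : ∑ K ∈ Ibar Q', P.w K = 1 := by
      rw [← P.w_sum]
      refine (Finset.sum_subset (Ibar_mono hsub) fun K _ hK => ?_).symm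
      by_contra h
      exact hK (P.w_supp K h)
    simp [moveWeight, Finset.sum_add_distrib, Finset.sum_sub_distrib, hs, hI, hJ]
  compat K _ hne hK := by
    unfold moveWeight
    by_cases hKJ : K = J
    · have := P.w_nonneg K
      by_cases hKI : K = I
      · subst hKI
        rw [if_pos rfl, if_pos hKJ]
        linarith
      · rw [if_neg hKI, if_pos hKJ]
        linarith
    · by_cases hKI : K = I
      · subst hKI
        simp [hKJ] at hK
      · have h : P.dgm K ≠ 0 := by simpa [hKI, hKJ] using hK
        simpa [hKI, hKJ] using P.compat K (P.supp K h) hne h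

theorem Ibar_map {Q Q' : Finset ℝ} {f : ℝ → ℝ} (hf : ∀ q ∈ Q', f q ∈ Q)
    (hmono : ∀ q ∈ Q', ∀ q' ∈ Q', q ≤ q' → f q ≤ f q') {J : ℝ × ℝ} (hJ : J ∈ Ibar Q') :
    (f J.1, f J.2) ∈ Ibar Q := by
  rw [mem_Ibar] at hJ ⊢
  exact ⟨hf _ hJ.1, hf _ hJ.2.1, hmono _ hJ.1 _ hJ.2.1 hJ.2.2⟩

/-- Pushing forward along a retraction of intervals leaves functions supported on the
smaller set of intervals unchanged and moves point masses. -/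
theorem sum_filter_retraction {M : Type*} [AddCommMonoid M] {Q Q' : Finset ℝ} (hsub : Q ⊆ Q')
    {f : ℝ → ℝ} (hid : ∀ q ∈ Q, f q = q) {u : ℝ × ℝ → M} (hu : ∀ K, K ∉ Ibar Q → u K = 0)
    {J : ℝ × ℝ} (hJ : J ∈ Ibar Q') (x : M) {K : ℝ × ℝ} (hK : K ∈ Ibar Q) :
    ∑ I ∈ (Ibar Q').filter (fun I => (f I.1, f I.2) = K), (u I + if I = J then x else 0) =
      u K + if K = (f J.1, f J.2) then x else 0 := by
  rw [Finset.sum_add_distrib]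
  congr 1
  · have hfix : ∀ I ∈ Ibar Q, (f I.1, f I.2) = I := fun I hI => by
      rw [mem_Ibar] at hI
      rw [hid _ hI.1, hid _ hI.2.1]
    refine Finset.sum_eq_single_of_mem K ?_ fun I hI hne => hu I fun hIQ => hne ?_
    · simpa [Ibar_mono hsub hK] using hfix K hK
    · rw [← (Finset.mem_filter.1 hI).2, hfix I hIQ]
  · simp [hJ, eq_comm]

/-- A monotone retraction `f` of `Q'` onto `Q` induces a morphism between moved diagrams. -/
def WPDgm.moveHom (P : WPDgm) {Q' : Finset ℝ} (hsub : P.Q ⊆ Q')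
    (hnonneg : ∀ q ∈ Q', (0 : ℝ) ≤ q) (f : ℝ → ℝ) (hf : ∀ q ∈ Q', f q ∈ P.Q)
    (hmono : ∀ q ∈ Q', ∀ q' ∈ Q', q ≤ q' → f q ≤ f q') (hid : ∀ q ∈ P.Q, f q = q)
    (I J : ℝ × ℝ) (hJ : J ∈ Ibar Q') (ε : ℝ) (hε : 0 < ε) (hεI : ε < P.w I) (n : ℕ) :
    WPDHom (P.move Q' hsub hnonneg I J hJ ε hε hεI n)
      (P.move P.Q subset_rfl P.nonneg I (f J.1, f J.2) (Ibar_map hf hmono hJ) ε hε hεI n) where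
  f := f
  g r := if h : ((Q'.filter fun q => f q ≤ r)).Nonempty then (Q'.filter fun q => f q ≤ r).max' h
    else 0
  f_mem := hf
  g_mem r hr := by
    have h : ((Q'.filter fun q => f q ≤ r)).Nonempty :=
      ⟨r, by simpa [(hid r hr).le] using hsub hr⟩
    simp only [dif_pos h]
    exact (Finset.mem_filter.1 (Finset.max'_mem _ h)).1
  f_mono := hmono
  g_mono r hr r' hr' hle := by
    have h : ∀ s ∈ P.Q, ((Q'.filter fun q => f q ≤ s)).Nonempty := fun s hs =>
      ⟨s, by simpa [(hid s hs).le] using hsub hs⟩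
    simp only [dif_pos (h r hr), dif_pos (h r' hr')]
    exact Finset.max'_subset _ fun q hq => by
      rw [Finset.mem_filter] at hq ⊢
      exact ⟨hq.1, hq.2.trans hle⟩
  gc q hq r hr := by
    have h : ((Q'.filter fun q => f q ≤ r)).Nonempty :=
      ⟨r, by simpa [(hid r hr).le] using hsub hr⟩
    simp only [dif_pos h]
    have hmax := Finset.mem_filter.1 (Finset.max'_mem _ h)
    exact ⟨fun hle => Finset.le_max' _ _ (Finset.mem_filter.2 ⟨hq, hle⟩),
      fun hle => (hmono _ hq _ hmax.1 hle).trans hmax.2⟩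
  push K hK _ := by
    refine (sum_filter_retraction (u := fun L => if L = I then 0 else P.dgm L) hsub hid
      (fun L hL => ?_) hJ n hK).symm
    have : P.dgm L = 0 := by
      by_contra h
      exact hL (P.supp L h)
    simp [this]
  monge K hK := by
    refine (sum_filter_retraction (u := fun L => P.w L - if L = I then ε else 0) hsub hid
      (fun L hL => ?_) hJ ε hK).symm
    have hL0 : P.w L = 0 := by
      by_contra h
      exact hL (P.w_supp L h)
    have hLI : L ≠ I := by
      rintro rfl
      linarith
    simp [hL0, hLI]

/-- The `p`-cost of `WPDgm.moveHom`, as a function of the amount `ε` of moved weight. -/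
def moveCost (p : ℝ≥0∞) (Q' : Finset ℝ) (f : ℝ → ℝ) (w : ℝ × ℝ → ℝ) (I J : ℝ × ℝ) (ε : ℝ) : ℝ :=
  (∑ I₁ ∈ Ibar Q', ∑ I₂ ∈ Ibar Q',
    defo I₁ I₂ (f I₁.1, f I₁.2) (f I₂.1, f I₂.2) ^ p.toReal
      * moveWeight w I J ε I₁ * moveWeight w I J ε I₂) ^ (1 / p.toReal)

theorem tendsto_moveCost {p : ℝ≥0∞} (hp : 1 ≤ p) (hptop : p ≠ ⊤) (P : WPDgm) (Q' : Finset ℝ)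
    {f : ℝ → ℝ} (hid : ∀ q ∈ P.Q, f q = q) (I J : ℝ × ℝ) :
    Filter.Tendsto (moveCost p Q' f P.w I J) (nhds 0) (nhds 0) := by
  have hp0 : 0 < p.toReal := ENNReal.toReal_pos (by positivity) hptop
  have hcont : Continuous (moveCost p Q' f P.w I J) := by
    have hw : ∀ K, Continuous fun ε => moveWeight P.w I J ε K := fun K => by
      unfold moveWeight
      split_ifs <;> fun_prop
    refine Continuous.rpow_const ?_ fun _ => Or.inr (by positivity)
    exact continuous_finsetSum _ fun I₁ _ => continuous_finsetSum _ fun I₂ _ =>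
      (continuous_const.mul (hw I₁)).mul (hw I₂)
  have hzero : moveCost p Q' f P.w I J 0 = 0 := by
    have hfix : ∀ K, P.w K ≠ 0 → (f K.1, f K.2) = K := fun K hK => by
      have := mem_Ibar.1 (P.w_supp K hK)
      rw [hid _ this.1, hid _ this.2.1]
    have hsum : ∀ I₁ I₂ : ℝ × ℝ, defo I₁ I₂ (f I₁.1, f I₁.2) (f I₂.1, f I₂.2) ^ p.toReal
        * P.w I₁ * P.w I₂ = 0 := fun I₁ I₂ => by
      by_cases h₁ : P.w I₁ = 0
      · simp [h₁]
      by_cases h₂ : P.w I₂ = 0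
      · simp [h₂]
      rw [hfix _ h₁, hfix _ h₂, defo_self, Real.zero_rpow hp0.ne', zero_mul, zero_mul]
    simp [moveCost, moveWeight, hsum, hp0.ne']
  simpa [hzero] using hcont.tendsto 0

theorem WPDgm.pcost_moveHom {p : ℝ≥0∞} (hptop : p ≠ ⊤) (P : WPDgm) {Q' : Finset ℝ}
    (hsub : P.Q ⊆ Q') (hnonneg : ∀ q ∈ Q', (0 : ℝ) ≤ q) (f : ℝ → ℝ) (hf : ∀ q ∈ Q', f q ∈ P.Q)
    (hmono : ∀ q ∈ Q', ∀ q' ∈ Q', q ≤ q' → f q ≤ f q') (hid : ∀ q ∈ P.Q, f q = q)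
    (I J : ℝ × ℝ) (hJ : J ∈ Ibar Q') (ε : ℝ) (hε : 0 < ε) (hεI : ε < P.w I) (n : ℕ) :
    (P.moveHom hsub hnonneg f hf hmono hid I J hJ ε hε hεI n).pcost p =
      moveCost p Q' f P.w I J ε :=
  if_neg hptop

/-- If `b` covers `c` in `Q`, then moving a small amount of weight, together with the whole
multiplicity, from `[a, b]` to `[a, c]` is cheap. -/
theorem exists_cost_move {p : ℝ≥0∞} (hp : 1 ≤ p) (hptop : p ≠ ⊤) (P : WPDgm) {a b c : ℝ}
    (hb : (a, b) ∈ Ibar P.Q) (hc : (a, c) ∈ Ibar P.Q) (hcb : c < b)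
    (hcov : ∀ q ∈ P.Q, q < b → q ≤ c) :
    ∃ F : ℝ → ℝ≥0∞, Filter.Tendsto F (nhds 0) (nhds 0) ∧
      ∀ ε (hε : 0 < ε) (hεI : ε < P.w (a, b)) (n : ℕ),
        editDistWDgm p
          (P.move P.Q subset_rfl P.nonneg (a, b) (a, b) hb ε hε hεI n)
          (P.move P.Q subset_rfl P.nonneg (a, b) (a, c) hc ε hε hεI n) ≤ F ε ∧
        editDistWDgm p
          (P.move P.Q subset_rfl P.nonneg (a, b) (a, c) hc ε hε hεI n)
          (P.move P.Q subset_rfl P.nonneg (a, b) (a, b) hb ε hε hεI n) ≤ F ε := by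
  obtain ⟨haQ, hbQ, hab⟩ := mem_Ibar.1 hb
  obtain ⟨-, hcQ, hac⟩ := mem_Ibar.1 hc
  simp only at haQ hbQ hab hcQ hac
  obtain ⟨d, hcd, hdb⟩ := exists_between hcb
  have hdQ : d ∉ P.Q := fun h => (hcov d h hdb).not_gt hcd
  set Q' := insert d P.Q with hQ'
  have hsub : P.Q ⊆ Q' := Finset.subset_insert _ _
  have hnonneg : ∀ q ∈ Q', (0 : ℝ) ≤ q := by
    simpa [hQ'] using ⟨(P.nonneg c hcQ).trans hcd.le, P.nonneg⟩
  have hJ : (a, d) ∈ Ibar Q' := mem_Ibar.2 ⟨hsub haQ, by simp [hQ'], hac.trans hcd.le⟩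
  let f : ℝ → ℝ → ℝ := fun x q => if q = d then x else q
  have hid : ∀ x, ∀ q ∈ P.Q, f x q = q := fun x q hq => if_neg (by rintro rfl; exact hdQ hq)
  have hf : ∀ x ∈ P.Q, ∀ q ∈ Q', f x q ∈ P.Q := fun x hx q hq => by
    rcases Finset.mem_insert.1 hq with rfl | hq
    · simpa [f] using hx
    · rwa [hid x q hq]
  have hmono : ∀ x, c ≤ x → x ≤ b → ∀ q ∈ Q', ∀ q' ∈ Q', q ≤ q' → f x q ≤ f x q' := by
    intro x hcx hxb q hq q' hq' hle
    rcases Finset.mem_insert.1 hq with rfl | hqQ <;> rcases Finset.mem_insert.1 hq' with rfl | hqQ'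
    · rfl
    · rw [hid x q' hqQ']
      simp only [f, if_true]
      refine hxb.trans (le_of_not_gt fun h => ?_)
      linarith [hcov q' hqQ' h]
    · rw [hid x q hqQ]
      simp only [f, if_true]
      exact (hcov q hqQ (by linarith)).trans hcx
    · rwa [hid x q hqQ, hid x q' hqQ']
  have hfJ : ∀ x, (f x a, f x d) = (a, x) := fun x => by rw [hid x a haQ]; simp [f]
  have key : ∀ x (hx : (a, x) ∈ Ibar P.Q) (hcx : c ≤ x) (hxb : x ≤ b) ε (hε : 0 < ε)
      (hεI : ε < P.w (a, b)) (n : ℕ),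
      editDistWDgm p (P.move Q' hsub hnonneg (a, b) (a, d) hJ ε hε hεI n)
        (P.move P.Q subset_rfl P.nonneg (a, b) (a, x) hx ε hε hεI n) ≤
          ENNReal.ofReal (moveCost p Q' (f x) P.w (a, b) (a, d) ε) ∧
      editDistWDgm p (P.move P.Q subset_rfl P.nonneg (a, b) (a, x) hx ε hε hεI n)
        (P.move Q' hsub hnonneg (a, b) (a, d) hJ ε hε hεI n) ≤
          ENNReal.ofReal (moveCost p Q' (f x) P.w (a, b) (a, d) ε) := by
    intro x hx hcx hxb ε hε hεI n
    have hxQ : x ∈ P.Q := (mem_Ibar.1 hx).2.1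
    have hcost := P.pcost_moveHom hptop hsub hnonneg (f x) (hf x hxQ) (hmono x hcx hxb) (hid x)
      (a, b) (a, d) hJ ε hε hεI n
    have h₁ := editDistWDgm_le_pcost p (P.moveHom hsub hnonneg (f x) (hf x hxQ)
      (hmono x hcx hxb) (hid x) (a, b) (a, d) hJ ε hε hεI n)
    have h₂ := editDistWDgm_le_pcost_swap p (P.moveHom hsub hnonneg (f x) (hf x hxQ)
      (hmono x hcx hxb) (hid x) (a, b) (a, d) hJ ε hε hεI n)
    rw [hcost] at h₁ h₂
    simp only [hfJ] at h₁ h₂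
    exact ⟨h₁, h₂⟩
  refine ⟨fun ε => ENNReal.ofReal (moveCost p Q' (f b) P.w (a, b) (a, d) ε) +
    ENNReal.ofReal (moveCost p Q' (f c) P.w (a, b) (a, d) ε), ?_, fun ε hε hεI n => ⟨?_, ?_⟩⟩
  · simpa using (ENNReal.tendsto_ofReal (tendsto_moveCost hp hptop P Q' (hid b) _ _)).add
      (ENNReal.tendsto_ofReal (tendsto_moveCost hp hptop P Q' (hid c) _ _))
  · exact (editDistWDgm_triangle p _ _ _).trans
      (add_le_add (key b hb hcb.le le_rfl ε hε hεI n).2 (key c hc le_rfl hcb.le ε hε hεI n).1)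
  · refine le_of_le_of_eq ?_ (add_comm _ _)
    exact (editDistWDgm_triangle p _ _ _).trans
      (add_le_add (key c hc le_rfl hcb.le ε hε hεI n).2 (key b hb hcb.le le_rfl ε hε hεI n).1)

/-- Changing the multiplicity of a single interval does not affect the edit distance. -/
theorem editDistWDgm_eq_zero_of_eq_off_interval {p : ℝ≥0∞} (hp : 1 ≤ p) (hptop : p ≠ ⊤)
    {P₁ P₂ : WPDgm} (hQ : P₁.Q = P₂.Q) (hw : P₁.w = P₂.w) {a b : ℝ} (hI : (a, b) ∈ Ibar P₁.Q)
    (hdgm : ∀ K, K ≠ (a, b) → P₁.dgm K = P₂.dgm K) :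
    editDistWDgm p P₁ P₂ = 0 := by
  induction hk : (P₁.Q.filter (· < b)).card using Nat.strong_induction_on
    generalizing P₁ P₂ b with
  | _ k ih =>
  obtain ⟨haQ, hbQ, hab⟩ := mem_Ibar.1 hI
  simp only at haQ hbQ hab
  rcases hab.eq_or_lt with rfl | hlt
  · exact editDistWDgm_eq_zero_of_eq_off_diag hp hptop hQ hw fun J hJ =>
      hdgm J (by rintro rfl; exact hJ rfl)
  rcases (P₁.w_nonneg (a, b)).eq_or_lt with hw0 | hwpos
  · refine editDistWDgm_eq_zero_of_eq_off_diag hp hptop hQ hw fun J hJ => ?_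
    by_cases hJI : J = (a, b)
    · subst hJI
      have h₁ : P₁.dgm (a, b) = 0 := by
        by_contra h
        exact (P₁.compat _ hI hJ h).ne hw0
      have h₂ : P₂.dgm (a, b) = 0 := by
        by_contra h
        exact (P₂.compat _ (hQ ▸ hI) hJ h).ne (hw ▸ hw0)
      rw [h₁, h₂]
    · exact hdgm J hJI
  obtain ⟨c, hcmem, hcmax⟩ := (P₁.Q.filter (· < b)).exists_max_image id
    ⟨a, Finset.mem_filter.2 ⟨haQ, hlt⟩⟩
  obtain ⟨hcQ, hcb⟩ := Finset.mem_filter.1 hcmem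
  have hcov : ∀ q ∈ P₁.Q, q < b → q ≤ c := fun q hq hqb =>
    hcmax q (Finset.mem_filter.2 ⟨hq, hqb⟩)
  have hc : (a, c) ∈ Ibar P₁.Q := mem_Ibar.2 ⟨haQ, hcQ, hcov a haQ hlt⟩
  have hcard : (P₁.Q.filter (· < c)).card < k := by
    rw [← hk]
    refine Finset.card_lt_card ⟨fun q hq => ?_, fun h => ?_⟩
    · rw [Finset.mem_filter] at hq ⊢
      exact ⟨hq.1, hq.2.trans hcb⟩
    · exact lt_irrefl c (Finset.mem_filter.1 (h hcmem)).2
  obtain ⟨F, hF, hmove⟩ := exists_cost_move hp hptop P₁ hI hc hcb hcov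
  have hbound : ∀ ε, 0 < ε → ε < P₁.w (a, b) → editDistWDgm p P₁ P₂ ≤ F ε + F ε := by
    intro ε hε hεI
    let M : ∀ J ∈ Ibar P₁.Q, ℕ → WPDgm := fun J hJ n =>
      P₁.move P₁.Q subset_rfl P₁.nonneg (a, b) J hJ ε hε hεI n
    have hweight : (moveWeight P₁.w (a, b) (a, b) ε) = P₁.w := by
      funext K
      simp [moveWeight]
    have hstart : editDistWDgm p P₁ (M (a, b) hI (P₁.dgm (a, b))) = 0 := by
      refine editDistWDgm_eq_zero_of_eq_off_diag hp hptop rfl hweight.symm fun K _ => ?_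
      by_cases hK : K = (a, b) <;> simp [M, WPDgm.move, hK]
    have hmid : editDistWDgm p (M (a, c) hc (P₁.dgm (a, b))) (M (a, c) hc (P₂.dgm (a, b))) = 0 :=
      ih _ hcard rfl rfl hc (fun K hK => by simp [M, WPDgm.move, hK]) rfl
    have hend : editDistWDgm p (M (a, b) hI (P₂.dgm (a, b))) P₂ = 0 := by
      refine editDistWDgm_eq_zero_of_eq_off_diag hp hptop hQ (hweight.trans hw) fun K _ => ?_
      by_cases hK : K = (a, b) <;> simp [M, WPDgm.move, hK, hdgm]
    calc editDistWDgm p P₁ P₂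
        ≤ editDistWDgm p P₁ (M (a, b) hI (P₁.dgm (a, b))) +
          (editDistWDgm p (M (a, b) hI (P₁.dgm (a, b))) (M (a, c) hc (P₁.dgm (a, b))) +
          (editDistWDgm p (M (a, c) hc (P₁.dgm (a, b))) (M (a, c) hc (P₂.dgm (a, b))) +
          (editDistWDgm p (M (a, c) hc (P₂.dgm (a, b))) (M (a, b) hI (P₂.dgm (a, b))) +
          editDistWDgm p (M (a, b) hI (P₂.dgm (a, b))) P₂))) := by
          refine (editDistWDgm_triangle p _ _ _).trans (add_le_add le_rfl ?_)
          refine (editDistWDgm_triangle p _ _ _).trans (add_le_add le_rfl ?_)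
          refine (editDistWDgm_triangle p _ _ _).trans (add_le_add le_rfl ?_)
          exact editDistWDgm_triangle p _ _ _
      _ ≤ F ε + F ε := by
          rw [hstart, hmid, hend, zero_add, zero_add, add_zero]
          exact add_le_add (hmove ε hε hεI _).1 (hmove ε hε hεI _).2
  have hlim : Filter.Tendsto (fun ε => F ε + F ε) (nhdsWithin 0 (Set.Ioi 0)) (nhds 0) := by
    simpa using (hF.add hF).mono_left nhdsWithin_le_nhds
  refine le_antisymm (ge_of_tendsto hlim ?_) zero_le
  filter_upwards [Ioo_mem_nhdsGT hwpos] with ε hε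
  exact hbound ε hε.1 hε.2

theorem editDistWDgm_eq_zero_of_eq_off_finset {p : ℝ≥0∞} (hp : 1 ≤ p) (hptop : p ≠ ⊤)
    (S : Finset (ℝ × ℝ)) {P₁ P₂ : WPDgm} (hQ : P₁.Q = P₂.Q) (hw : P₁.w = P₂.w)
    (hS : S ⊆ Ibar P₁.Q) (hdgm : ∀ K, K ∉ S → P₁.dgm K = P₂.dgm K) :
    editDistWDgm p P₁ P₂ = 0 := by
  induction S using Finset.induction_on generalizing P₁ with
  | empty =>
    exact editDistWDgm_eq_zero_of_eq_off_diag hp hptop hQ hw fun J _ => hdgm J (by simp)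
  | insert I S _ ih =>
    obtain ⟨hI, hS⟩ := Finset.insert_subset_iff.1 hS
    let P : WPDgm :=
      { P₁ with
        dgm := Function.update P₁.dgm I (P₂.dgm I)
        supp := fun K hK => by
          by_cases hKI : K = I
          · rwa [hKI]
          · exact P₁.supp K (by simpa [hKI] using hK)
        compat := fun K hK hne hK0 => by
          by_cases hKI : K = I
          · subst hKI
            exact hw ▸ P₂.compat K (hQ ▸ hK) hne (by simpa using hK0)
          · exact P₁.compat K hK hne (by simpa [hKI] using hK0) }
    have h₁ : editDistWDgm p P₁ P = 0 :=
      editDistWDgm_eq_zero_of_eq_off_interval hp hptop rfl rfl (a := I.1) (b := I.2) hI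
        fun K hK => (Function.update_of_ne hK _ _).symm
    have h₂ : editDistWDgm p P P₂ = 0 := by
      refine ih (P₁ := P) hQ hw hS fun K hK => ?_
      by_cases hKI : K = I
      · simp [P, hKI]
      · simpa [P, hKI] using hdgm K (by simp [hKI, hK])
    simpa [h₁, h₂] using editDistWDgm_triangle p P₁ P P₂

theorem editDistWDgm_eq_zero_of_eq_weights
    (p : ℝ≥0∞) (hp : 1 ≤ p) (hptop : p ≠ ⊤)
    (P₀ P₁ : WPDgm) (hQ : P₀.Q = P₁.Q) (hw : P₀.w = P₁.w) :
    editDistWDgm p P₀ P₁ = 0 := by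
  refine editDistWDgm_eq_zero_of_eq_off_finset hp hptop (Ibar P₀.Q) hQ hw subset_rfl
    fun K hK => ?_
  have h₀ : P₀.dgm K = 0 := by
    by_contra h
    exact hK (P₀.supp K h)
  have h₁ : P₁.dgm K = 0 := by
    by_contra h
    exact hK (hQ ▸ P₁.supp K h)
  rw [h₀, h₁]
end
end

section
/- Let w-σ : (Q̄, μ_Q̄) → ℕ and w-τ : (R̄, μ_R̄) → ℕ be weighted persistence diagrams with underlying persistence diagrams σ and τ. Then d^E_Dgm(σ, τ) ≤ d^{E,∞}_wDgm(w-σ, w-τ). -/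
/-!
STATEMENT 17: Let `w-σ : (Q̄, μ_Q̄) → ℕ` and `w-τ : (R̄, μ_R̄) → ℕ` be weighted
persistence diagrams with underlying persistence diagrams `σ` and `τ`.  Then
`d^E_Dgm(σ, τ) ≤ d^{E,∞}_wDgm(w-σ, w-τ)`.
-/

open scoped ENNReal

noncomputable section

/-- The ℓ∞ distance between two intervals. -/
def distLinf (I J : ℝ × ℝ) : ℝ := max |I.1 - J.1| |I.2 - J.2|

/-- A persistence diagram. -/
structure PDgm where
  Q : Finset ℝ
  nonneg : ∀ q ∈ Q, (0:ℝ) ≤ q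
  zero_mem : (0:ℝ) ∈ Q
  dgm : ℝ × ℝ → ℕ
  supp : ∀ I, dgm I ≠ 0 → I ∈ Ibar Q

/-- A persistence diagram morphism. -/
structure PDHom (P₁ P₂ : PDgm) where
  f : ℝ → ℝ
  g : ℝ → ℝ
  f_mem : ∀ q ∈ P₁.Q, f q ∈ P₂.Q
  g_mem : ∀ r ∈ P₂.Q, g r ∈ P₁.Q
  f_mono : ∀ q ∈ P₁.Q, ∀ q' ∈ P₁.Q, q ≤ q' → f q ≤ f q'
  g_mono : ∀ r ∈ P₂.Q, ∀ r' ∈ P₂.Q, r ≤ r' → g r ≤ g r'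
  gc : ∀ q ∈ P₁.Q, ∀ r ∈ P₂.Q, (f q ≤ r ↔ q ≤ g r)
  push : ∀ J ∈ Ibar P₂.Q, J.1 ≠ J.2 →
    P₂.dgm J = ∑ I ∈ (Ibar P₁.Q).filter (fun I => (f I.1, f I.2) = J), P₁.dgm I

/-- The cost of a persistence diagram morphism: the distortion of `f̄`. -/
def PDHom.cost {P₁ P₂ : PDgm} (m : PDHom P₁ P₂) : ℝ :=
  sSup {v | ∃ I ∈ Ibar P₁.Q, ∃ J ∈ Ibar P₁.Q,
    v = |distLinf I J - distLinf (m.f I.1, m.f I.2) (m.f J.1, m.f J.2)|}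

/-- A zigzag path of persistence diagram morphisms. -/
inductive PDPath : PDgm → PDgm → Type
  | nil (P : PDgm) : PDPath P P
  | fwd {P₁ P₂ P₃ : PDgm} (m : PDHom P₁ P₂) (p : PDPath P₂ P₃) : PDPath P₁ P₃
  | bwd {P₁ P₂ P₃ : PDgm} (m : PDHom P₂ P₁) (p : PDPath P₂ P₃) : PDPath P₁ P₃

/-- The cost of a path of persistence diagram morphisms. -/
def pdPathCost : ∀ {P₁ P₂ : PDgm}, PDPath P₁ P₂ → ℝ
  | _, _, .nil _ => 0
  | _, _, .fwd m p => m.cost + pdPathCost p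
  | _, _, .bwd m p => m.cost + pdPathCost p

/-- The edit distance between persistence diagrams. -/
def editDistDgm (P₁ P₂ : PDgm) : ℝ≥0∞ :=
  ⨅ p : PDPath P₁ P₂, ENNReal.ofReal (pdPathCost p)

/-- The underlying (unweighted) persistence diagram of a weighted persistence
diagram. -/
def WPDgm.toPD (P : WPDgm) : PDgm :=
  ⟨P.Q, P.nonneg, P.zero_mem, P.dgm, P.supp⟩

/-- The ∞-cost of a weighted persistence diagram morphism: the maximal displacement
`defo(I₁, I₂, f̄ I₁, f̄ I₂)` over `I₁, I₂ ∈ Q̄`. -/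
def WPDHom.costInf {P₁ P₂ : WPDgm} (m : WPDHom P₁ P₂) : ℝ :=
  sSup {v | ∃ I₁ ∈ Ibar P₁.Q, ∃ I₂ ∈ Ibar P₁.Q,
    v = defo I₁ I₂ (m.f I₁.1, m.f I₁.2) (m.f I₂.1, m.f I₂.2)}

/-- The ∞-cost of a path of weighted persistence diagram morphisms. -/
def wpdPathCostInf : ∀ {P₁ P₂ : WPDgm}, WPDPath P₁ P₂ → ℝ
  | _, _, .nil _ => 0
  | _, _, .fwd m p => m.costInf + wpdPathCostInf p
  | _, _, .bwd m p => m.costInf + wpdPathCostInf p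

/-- The ∞-edit distance between weighted persistence diagrams. -/
def editDistWDgmInf (P₁ P₂ : WPDgm) : ℝ≥0∞ :=
  ⨅ q : WPDPath P₁ P₂, ENNReal.ofReal (wpdPathCostInf q)

/-- The distortion of a pair of intervals is at most its displacement. -/
lemma abs_distLinf_sub_distLinf_le_defo (I₁ I₂ J₁ J₂ : ℝ × ℝ) :
    |distLinf I₁ I₂ - distLinf J₁ J₂| ≤ defo I₁ I₂ J₁ J₂ := by
  refine (abs_max_sub_max_le_max _ _ _ _).trans ?_
  refine max_le ((abs_abs_sub_abs_le _ _).trans ?_) ((abs_abs_sub_abs_le _ _).trans ?_)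
  · exact (le_max_left _ _).trans (le_max_left _ _)
  · exact (le_max_right _ _).trans (le_max_right _ _)

/-- The displacements of the pairs of intervals of `Q` are bounded above, by finiteness. -/
lemma bddAbove_defo (Q : Finset ℝ) (f : ℝ → ℝ) :
    BddAbove {v | ∃ I₁ ∈ Ibar Q, ∃ I₂ ∈ Ibar Q,
      v = defo I₁ I₂ (f I₁.1, f I₁.2) (f I₂.1, f I₂.2)} := by
  refine ((Ibar Q ×ˢ Ibar Q).finite_toSet.image fun p =>
    defo p.1 p.2 (f p.1.1, f p.1.2) (f p.2.1, f p.2.2)).bddAbove.mono ?_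
  rintro _ ⟨I₁, h₁, I₂, h₂, rfl⟩
  exact ⟨(I₁, I₂), Finset.mem_coe.2 (Finset.mk_mem_product h₁ h₂), rfl⟩

/-- The underlying persistence diagram morphism of a weighted one. -/
def WPDHom.toPDHom {P₁ P₂ : WPDgm} (m : WPDHom P₁ P₂) : PDHom P₁.toPD P₂.toPD :=
  ⟨m.f, m.g, m.f_mem, m.g_mem, m.f_mono, m.g_mono, m.gc, m.push⟩

lemma WPDHom.cost_toPDHom_le {P₁ P₂ : WPDgm} (m : WPDHom P₁ P₂) :
    m.toPDHom.cost ≤ m.costInf := by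
  have h₀ : ((0 : ℝ), (0 : ℝ)) ∈ Ibar P₁.Q := by simp [Ibar, P₁.zero_mem]
  refine csSup_le ⟨_, (0, 0), h₀, (0, 0), h₀, rfl⟩ ?_
  rintro _ ⟨I₁, h₁, I₂, h₂, rfl⟩
  exact (abs_distLinf_sub_distLinf_le_defo _ _ _ _).trans
    (le_csSup (bddAbove_defo P₁.Q m.f) ⟨I₁, h₁, I₂, h₂, rfl⟩)

/-- The underlying path of persistence diagram morphisms of a weighted one. -/
def WPDPath.toPDPath : ∀ {P₁ P₂ : WPDgm}, WPDPath P₁ P₂ → PDPath P₁.toPD P₂.toPD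
  | _, _, .nil P => .nil P.toPD
  | _, _, .fwd m p => .fwd m.toPDHom p.toPDPath
  | _, _, .bwd m p => .bwd m.toPDHom p.toPDPath

lemma WPDPath.pdPathCost_toPDPath_le {P₁ P₂ : WPDgm} (p : WPDPath P₁ P₂) :
    pdPathCost p.toPDPath ≤ wpdPathCostInf p := by
  induction p with
  | nil P => exact le_rfl
  | fwd m p ih => exact add_le_add m.cost_toPDHom_le ih
  | bwd m p ih => exact add_le_add m.cost_toPDHom_le ih

theorem editDistDgm_le_editDistWDgmInf (P₁ P₂ : WPDgm) :
    editDistDgm P₁.toPD P₂.toPD ≤ editDistWDgmInf P₁ P₂ := by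
  exact le_iInf fun p => (iInf_le _ p.toPDPath).trans
    (ENNReal.ofReal_le_ofReal p.pdPathCost_toPDPath_le)
end
end
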